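/- arXiv:2001.10905 — 5 statements merged into one kernel-verified Lean document; each statement's English description precedes it below -/
import Mathlib

section
/- (Theorems 2 and 3: the Bayesian networks obtained from SPNs and selective SPNs admit only trivial interventions.) Let a factorized Bayesian-network model over variables V be given, admitting a topological ordering, and suppose V is partitioned into a set L (latent variables) and a set O (observable variables) such that pa l = ∅ for every l ∈ L and pa o ⊆ L for every o ∈ O (the bipartite structure, with edges only from latent to observable nodes, produced by transforming an SPN or a selective SPN into a Bayesian network). Then for every subset T ⊆ O, every assignment ξ on T, and every assignment τ on V ∖ T: ∑_{σ agreeing with τ on V ∖ T} P_{do(T=ξ)}(σ) = P_{V∖T}(τ); in particular the joint distribution of the remaining observable variables satisfies P(v_{−x} | do(x)) = P(v_{−x}). -/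
open Finset

variable {V : Type*} [Fintype V] [DecidableEq V]
variable {S : V → Type*} [∀ v, Fintype (S v)] [∀ v, DecidableEq (S v)] [∀ v, Nonempty (S v)]

/-- The joint pmf of a factorized Bayesian-network model:
`P(σ) = ∏ v, k v σ (σ v)`. -/
noncomputable def jointP (k : ∀ v, (∀ u, S u) → S v → NNReal) (σ : ∀ v, S v) : NNReal :=
  ∏ v, k v σ (σ v)

/-- The marginal of a pmf `p` on a finite set `W` of variables at an assignment `w`:
the sum of `p σ` over all full assignments `σ` agreeing with `w` on `W`. -/
noncomputable def marginal (p : (∀ v, S v) → NNReal) (W : Finset V) (w : ∀ v, S v) : NNReal :=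
  ∑ σ : ∀ v, S v, if ∀ u ∈ W, σ u = w u then p σ else 0

/-- The interventional (truncated-factorization) pmf obtained by `do(T = ξ)`:
`P_{do(T=ξ)}(σ) = ∏_{v ∉ T} k v σ (σ v)` if `σ` agrees with `ξ` on `T`, else `0`. -/
noncomputable def doP (k : ∀ v, (∀ u, S u) → S v → NNReal) (T : Finset V) (ξ : ∀ v, S v)
    (σ : ∀ v, S v) : NNReal :=
  if ∀ u ∈ T, σ u = ξ u then ∏ v ∈ Tᶜ, k v σ (σ v) else 0

omit [∀ v, Nonempty (S v)] in
/-- If the kernels at every assignment agreeing with `τ` on `W` equal those at `τ`, and the kernels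
outside `W` are normalized, then the marginal of the joint pmf on `W` at `τ` is the product of the
kernels over `W`. -/
theorem marginal_jointP_eq_prod (k : ∀ v, (∀ u, S u) → S v → NNReal) (W : Finset V)
    (τ : ∀ v, S v)
    (hk : ∀ v (σ : ∀ u, S u), (∀ u ∈ W, σ u = τ u) → k v σ = k v τ)
    (hnorm : ∀ v ∉ W, ∑ a : S v, k v τ a = 1) :
    marginal (jointP k) W τ = ∏ v ∈ W, k v τ (τ v) := by
  have hmem (σ : ∀ v, S v) :
      σ ∈ Fintype.piFinset (fun v => if v ∈ W then {τ v} else univ) ↔ ∀ u ∈ W, σ u = τ u := by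
    simp only [Fintype.mem_piFinset]
    refine forall_congr' fun u => ?_
    by_cases hu : u ∈ W <;> simp [hu]
  calc marginal (jointP k) W τ
      = ∑ σ ∈ Fintype.piFinset (fun v => if v ∈ W then {τ v} else univ),
          ∏ v, k v τ (σ v) := by
        rw [marginal, ← sum_filter]
        refine sum_congr (by ext σ; rw [hmem]; simp) fun σ hσ => ?_
        rw [hmem] at hσ
        exact prod_congr rfl fun v _ => by rw [hk v σ hσ]
    _ = ∏ v, ∑ a ∈ (if v ∈ W then {τ v} else univ), k v τ a :=
        (prod_univ_sum _ _).symm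
    _ = ∏ v ∈ W, ∑ a ∈ (if v ∈ W then {τ v} else univ), k v τ a :=
        (prod_subset (subset_univ W) fun v _ hv => by simpa [hv] using hnorm v hv).symm
    _ = ∏ v ∈ W, k v τ (τ v) := prod_congr rfl fun v hv => by simp [hv]

omit [∀ v, Fintype (S v)] [∀ v, Nonempty (S v)] in
/-- Truncated factorization is the joint pmf of the model whose kernels on `T` are replaced by
point masses at `ξ`. -/
theorem doP_eq_jointP (k : ∀ v, (∀ u, S u) → S v → NNReal) (T : Finset V) (ξ : ∀ v, S v) :
    doP k T ξ =
      jointP fun v σ a => if v ∈ T then (if a = ξ v then 1 else 0) else k v σ a := by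
  funext σ
  rw [doP, jointP, ← prod_mul_prod_compl T]
  have h₁ : ∏ v ∈ T, (if v ∈ T then (if σ v = ξ v then 1 else 0) else k v σ (σ v)) =
      if ∀ u ∈ T, σ u = ξ u then 1 else 0 := by
    rw [prod_congr rfl fun v hv => if_pos hv, prod_ite_zero, prod_const_one]
    congr
  have h₂ : ∏ v ∈ Tᶜ, (if v ∈ T then (if σ v = ξ v then 1 else 0) else k v σ (σ v)) =
      ∏ v ∈ Tᶜ, k v σ (σ v) :=
    prod_congr rfl fun v hv => if_neg (mem_compl.mp hv)
  rw [h₁, h₂, ite_mul, one_mul, zero_mul]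

/-- **Theorems 2 and 3.** In the bipartite Bayesian network obtained by transforming an
SPN (or a selective SPN), where `V = L ∪ O` with latent roots `L` and observables `O`
whose parents all lie in `L`, every intervention on a subset `T ⊆ O` of observables is
trivial: the interventional marginal on `V ∖ T` equals the observational marginal. -/
theorem spn_bn_intervention_trivial
    (pa : V → Finset V)
    (k : ∀ v, (∀ u, S u) → S v → NNReal)
    (hpa : ∀ v, v ∉ pa v)
    (hloc : ∀ v (σ σ' : ∀ u, S u), (∀ u ∈ pa v, σ u = σ' u) → k v σ = k v σ')
    (hnorm : ∀ v (σ : ∀ u, S u), ∑ a : S v, k v σ a = 1)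
    (htopo : ∃ ρ : V → ℕ, Function.Injective ρ ∧ ∀ u v, u ∈ pa v → ρ u < ρ v)
    (L O : Finset V)
    (hpart : L ∪ O = Finset.univ) (hdisj : Disjoint L O)
    (hL : ∀ l ∈ L, pa l = ∅)
    (hO : ∀ o ∈ O, pa o ⊆ L)
    (T : Finset V) (hT : T ⊆ O)
    (ξ τ : ∀ v, S v) :
    marginal (doP k T ξ) Tᶜ τ = marginal (jointP k) Tᶜ τ := by
  have hpaT (v : V) : pa v ⊆ Tᶜ := by
    have hLT : L ⊆ Tᶜ := fun l hl =>
      mem_compl.mpr fun hlT => disjoint_left.mp hdisj hl (hT hlT)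
    rcases mem_union.mp (hpart ▸ mem_univ v) with hv | hv
    · simp [hL v hv]
    · exact (hO v hv).trans hLT
  have hk (v : V) (σ : ∀ u, S u) (hσ : ∀ u ∈ Tᶜ, σ u = τ u) : k v σ = k v τ :=
    hloc v σ τ fun u hu => hσ u (hpaT v hu)
  rw [doP_eq_jointP, marginal_jointP_eq_prod k Tᶜ τ hk fun v _ => hnorm v τ,
    marginal_jointP_eq_prod _ Tᶜ τ (fun v σ hσ => by simp only [hk v σ hσ])
      fun v hv => by simp [notMem_compl.mp hv]]
  exact prod_congr rfl fun v hv => if_neg (mem_compl.mp hv)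
end

section
/- (Theorem 4: the SEM built by Algorithm 1 agrees with the PSDD distribution on the original variables.) Let a factorized Bayesian-network model over variables V be given, admitting a topological ordering. Suppose there is a node h : V and distinct nodes o 0, …, o (n−1) : V, all different from h, such that: pa h = ∅; the state space of h is S h = Π i : Fin n, S (o i); the kernel of h is k h σ a = p a for a fixed function p : (Π i : Fin n, S (o i)) → ℝ≥0 with ∑_a p a = 1; and for each i, pa (o i) = {h} with deterministic kernel k (o i) σ a = 1 if a = (σ h) i and 0 otherwise (the structural equations X_i = H_i). The remaining (augmented) variables of V are arbitrary. Then for every a : Π i : Fin n, S (o i), the joint marginal of (o 0, …, o (n−1)) under P equals p: P_{{o 0, …, o (n−1)}}(a) = p(a). -/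
open Finset

variable {V : Type*} [Fintype V] [DecidableEq V]
variable {S : V → Type*} [∀ v, Fintype (S v)] [∀ v, DecidableEq (S v)] [∀ v, Nonempty (S v)]

/-- Refining a marginal by one further variable `v`: sum over the values of `v`. -/
theorem marginal_eq_sum_marginal_insert (P : (∀ v, S v) → NNReal) {A : Finset V} {v : V}
    (hv : v ∉ A) (w : ∀ v, S v) :
    marginal P A w = ∑ x : S v, marginal P (insert v A) (Function.update w v x) := by
  unfold marginal
  rw [Finset.sum_comm]
  refine Finset.sum_congr rfl fun σ _ => ?_
  have key : ∀ x : S v, (∀ u ∈ insert v A, σ u = Function.update w v x u) ↔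
      σ v = x ∧ ∀ u ∈ A, σ u = w u := by
    intro x
    rw [Finset.forall_mem_insert, Function.update_self]
    refine and_congr_right fun _ => forall₂_congr fun u hu => ?_
    rw [Function.update_of_ne (ne_of_mem_of_not_mem hu hv)]
  simp only [key, ite_and]
  simp

/-- The marginal of a factorized model on an ancestral set is the product of the kernels
of that set. -/
theorem marginal_jointP_of_ancestral
    (pa : V → Finset V) (k : ∀ v, (∀ u, S u) → S v → NNReal)
    (hloc : ∀ v (σ σ' : ∀ u, S u), (∀ u ∈ pa v, σ u = σ' u) → k v σ = k v σ')
    (hnorm : ∀ v (σ : ∀ u, S u), ∑ a : S v, k v σ a = 1)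
    (ρ : V → ℕ) (hρ : ∀ u v, u ∈ pa v → ρ u < ρ v)
    (A : Finset V) (hA : ∀ v ∈ A, pa v ⊆ A) (w : ∀ v, S v) :
    marginal (jointP k) A w = ∏ v ∈ A, k v w (w v) := by
  induction hn : Aᶜ.card generalizing A w with
  | zero =>
    obtain rfl : A = Finset.univ := by simpa using hn
    simp [marginal, jointP, ← funext_iff]
  | succ m ih =>
    obtain ⟨v, hv, hmin⟩ := Finset.exists_min_image Aᶜ ρ (Finset.card_pos.mp (by omega))
    have hvA : v ∉ A := by simpa using hv
    have hpv : pa v ⊆ A := fun u hu => by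
      by_contra hu'
      exact absurd (hρ u v hu) (not_lt.mpr (hmin u (by simpa using hu')))
    have hagree : ∀ x, ∀ u, pa u ⊆ A → k u (Function.update w v x) = k u w := fun x u hu =>
      hloc u _ _ fun t ht => Function.update_of_ne (ne_of_mem_of_not_mem (hu ht) hvA) _ _
    have hstep : ∀ x : S v, marginal (jointP k) (insert v A) (Function.update w v x) =
        k v w x * ∏ u ∈ A, k u w (w u) := by
      intro x
      rw [ih (insert v A) _ _ _, Finset.prod_insert hvA, hagree x v hpv, Function.update_self]
      · congr 1
        refine Finset.prod_congr rfl fun u hu => ?_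
        rw [hagree x u (hA u hu), Function.update_of_ne (ne_of_mem_of_not_mem hu hvA)]
      · intro u hu
        rcases Finset.mem_insert.mp hu with rfl | hu
        · exact hpv.trans (Finset.subset_insert _ _)
        · exact (hA u hu).trans (Finset.subset_insert _ _)
      · rw [Finset.compl_insert, Finset.card_erase_of_mem hv, hn, Nat.add_sub_cancel]
    rw [marginal_eq_sum_marginal_insert _ hvA, Finset.sum_congr rfl fun x _ => hstep x,
      ← Finset.sum_mul, hnorm, one_mul]

/-- **Theorem 4.** In the SEM produced by Algorithm 1, with a latent root `h` whose
state space is (equivalent to) the product `Π i, S (o i)` and whose kernel is a fixed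
pmf `p`, and with each original variable `o i` having sole parent `h` and the
deterministic kernel `X_i = H_i`, the joint marginal of the original variables
`o 0, …, o (n-1)` under the joint pmf equals `p`. -/
theorem psdd_sem_agrees_on_original_variables
    (pa : V → Finset V)
    (k : ∀ v, (∀ u, S u) → S v → NNReal)
    (hpa : ∀ v, v ∉ pa v)
    (hloc : ∀ v (σ σ' : ∀ u, S u), (∀ u ∈ pa v, σ u = σ' u) → k v σ = k v σ')
    (hnorm : ∀ v (σ : ∀ u, S u), ∑ a : S v, k v σ a = 1)
    (htopo : ∃ ρ : V → ℕ, Function.Injective ρ ∧ ∀ u v, u ∈ pa v → ρ u < ρ v)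
    (n : ℕ) (h : V) (o : Fin n → V)
    (ho : Function.Injective o) (hoh : ∀ i, o i ≠ h)
    (hpah : pa h = ∅)
    (e : S h ≃ (∀ i, S (o i)))
    (p : (∀ i, S (o i)) → NNReal)
    (hp : ∑ a : ∀ i, S (o i), p a = 1)
    (hkh : ∀ (σ : ∀ u, S u) (a : S h), k h σ a = p (e a))
    (hpao : ∀ i, pa (o i) = {h})
    (hko : ∀ i (σ : ∀ u, S u) (a : S (o i)), k (o i) σ a = if a = e (σ h) i then 1 else 0)
    (a : ∀ i, S (o i)) (w : ∀ v, S v) (hw : ∀ i, w (o i) = a i) :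
    marginal (jointP k) (Finset.image o Finset.univ) w = p a := by
  obtain ⟨ρ, -, hρ⟩ := htopo
  have hh : h ∉ Finset.image o Finset.univ := by simpa using hoh
  have hanc : ∀ v ∈ insert h (Finset.image o Finset.univ),
      pa v ⊆ insert h (Finset.image o Finset.univ) := by
    intro v hv
    rcases Finset.mem_insert.mp hv with rfl | hv
    · simp [hpah]
    · obtain ⟨i, -, rfl⟩ := Finset.mem_image.mp hv
      simp [hpao]
  have hiff : ∀ x : S h, (∀ i ∈ Finset.univ, a i = e x i) ↔ e x = a := fun x => by
    simp only [Finset.mem_univ, true_imp_iff, funext_iff, eq_comm]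
  have hterm : ∀ x : S h, marginal (jointP k) (insert h (Finset.image o Finset.univ))
      (Function.update w h x) = if x = e.symm a then p a else 0 := by
    intro x
    rw [marginal_jointP_of_ancestral pa k hloc hnorm ρ hρ _ hanc, Finset.prod_insert hh,
      Finset.prod_image ho.injOn]
    simp only [hkh, hko, Function.update_self, Function.update_of_ne (hoh _), hw,
      Finset.prod_ite_zero, Finset.prod_const_one, hiff, Equiv.eq_symm_apply]
    by_cases hx : e x = a <;> simp [hx]
  rw [marginal_eq_sum_marginal_insert _ hh, Finset.sum_congr rfl fun x _ => hterm x]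
  simp
end

section
/- (Theorem 5: intervening on the original variables of the SEM built from a PSDD is trivial.) Let a factorized Bayesian-network model over variables V be given, admitting a topological ordering. Suppose there is a node h : V with pa h = ∅ and distinct nodes o 0, …, o (n−1) : V, all different from h, with pa (o i) = {h} for every i (the original PSDD variables, whose sole parent is the latent variable h); the remaining (augmented) variables of V are arbitrary but h does not belong to the parent-ancestry of any o i other than as stated. Let T be any subset of {o 0, …, o (n−1)} and W := {o 0, …, o (n−1)} ∖ T. Then for every assignment ξ on T and every assignment w on W, the interventional marginal on W equals the observational marginal: (P_{do(T=ξ)})_W(w) = P_W(w). -/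
open Finset

variable {V : Type*} [Fintype V] [DecidableEq V]
variable {S : V → Type*} [∀ v, Fintype (S v)] [∀ v, DecidableEq (S v)] [∀ v, Nonempty (S v)]

set_option linter.unusedSectionVars false in
/-- Summing out a coordinate `m` that only occurs in its own normalized kernel amounts to replacing
that kernel by the uniform one. -/
theorem sum_mul_kernel_eq_sum_mul_inv_card (m : V) (G : (∀ v, S v) → NNReal)
    (κ : (∀ v, S v) → S m → NNReal)
    (hG : ∀ σ σ', (∀ u, u ≠ m → σ u = σ' u) → G σ = G σ')
    (hκ : ∀ σ σ', (∀ u, u ≠ m → σ u = σ' u) → κ σ = κ σ')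
    (hnorm : ∀ σ, ∑ a, κ σ a = 1) :
    ∑ σ, G σ * κ σ (σ m) = ∑ σ, G σ * (Fintype.card (S m) : NNReal)⁻¹ := by
  rw [← (Equiv.piSplitAt m S).symm.sum_comp, ← (Equiv.piSplitAt m S).symm.sum_comp,
    Fintype.sum_prod_type_right, Fintype.sum_prod_type_right]
  refine Finset.sum_congr rfl fun r _ => ?_
  obtain ⟨a₀⟩ := (inferInstance : Nonempty (S m))
  have hagree : ∀ a u, u ≠ m → (Equiv.piSplitAt m S).symm (a, r) u
      = (Equiv.piSplitAt m S).symm (a₀, r) u := by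
    intro a u hu
    simp [Equiv.piSplitAt, hu]
  have hself : ∀ a, (Equiv.piSplitAt m S).symm (a, r) m = a := by
    intro a
    simp [Equiv.piSplitAt]
  have hcard : (Fintype.card (S m) : NNReal) ≠ 0 := Nat.cast_ne_zero.mpr Fintype.card_ne_zero
  simp_rw [hself, fun a => hG _ _ (hagree a), fun a => hκ _ _ (hagree a)]
  rw [← Finset.mul_sum, hnorm, Finset.sum_const, Finset.card_univ, nsmul_eq_mul]
  field_simp

set_option linter.unusedSectionVars false in
/-- Variables outside an ancestral set `A` can be summed out, leaving only the factors of `A`. -/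
theorem sum_mul_prod_union_eq_of_ancestral (pa : V → Finset V)
    (k : ∀ v, (∀ u, S u) → S v → NNReal)
    (hloc : ∀ v (σ σ' : ∀ u, S u), (∀ u ∈ pa v, σ u = σ' u) → k v σ = k v σ')
    (hnorm : ∀ v (σ : ∀ u, S u), ∑ a : S v, k v σ a = 1)
    (ρ : V → ℕ) (hρ : ∀ u v, u ∈ pa v → ρ u < ρ v)
    (A : Finset V) (hA : ∀ v ∈ A, pa v ⊆ A)
    (g : (∀ v, S v) → NNReal) (hg : ∀ σ σ', (∀ u ∈ A, σ u = σ' u) → g σ = g σ')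
    (D : Finset V) (hAD : Disjoint A D) :
    ∑ σ, g σ * ∏ v ∈ A ∪ D, k v σ (σ v)
      = (∏ v ∈ D, (Fintype.card (S v) : NNReal)⁻¹) * ∑ σ, g σ * ∏ v ∈ A, k v σ (σ v) := by
  induction D using Finset.induction_on_max_value ρ with
  | empty => simp
  | insert m D hm hmax ih =>
    rw [Finset.disjoint_insert_right] at hAD
    have hmAD : m ∉ A ∪ D := by simp [hAD.1, hm]
    have hpa : ∀ v ∈ A ∪ D, m ∉ pa v := by
      intro v hv hmv
      rcases Finset.mem_union.mp hv with hv | hv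
      · exact hAD.1 (hA v hv hmv)
      · exact (hρ m v hmv).not_ge (hmax v hv)
    have key := sum_mul_kernel_eq_sum_mul_inv_card m
      (fun σ => g σ * ∏ v ∈ A ∪ D, k v σ (σ v)) (k m)
      (fun σ σ' hσ => by
        rw [hg σ σ' fun u hu => hσ u (ne_of_mem_of_not_mem hu hAD.1)]
        congr 1
        refine Finset.prod_congr rfl fun v hv => ?_
        rw [hloc v σ σ' fun u hu => hσ u (ne_of_mem_of_not_mem hu (hpa v hv)),
          hσ v (ne_of_mem_of_not_mem hv hmAD)])
      (fun σ σ' hσ => hloc m σ σ' fun u hu =>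
        hσ u fun hum => (hρ u m hu).ne (congrArg ρ hum))
      (hnorm m)
    calc ∑ σ, g σ * ∏ v ∈ A ∪ insert m D, k v σ (σ v)
        = ∑ σ, (g σ * ∏ v ∈ A ∪ D, k v σ (σ v)) * k m σ (σ m) := by
          refine Finset.sum_congr rfl fun σ _ => ?_
          rw [Finset.union_insert, Finset.prod_insert hmAD]
          ring
      _ = _ := by
          rw [key, ← Finset.sum_mul, ih hAD.2, Finset.prod_insert hm]
          ring

/-- The marginal on a subset of an ancestral set `A` depends only on the kernels of `A`. -/
theorem marginal_jointP_congr_of_ancestral (pa : V → Finset V)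
    (k k' : ∀ v, (∀ u, S u) → S v → NNReal)
    (hloc : ∀ v (σ σ' : ∀ u, S u), (∀ u ∈ pa v, σ u = σ' u) → k v σ = k v σ')
    (hloc' : ∀ v (σ σ' : ∀ u, S u), (∀ u ∈ pa v, σ u = σ' u) → k' v σ = k' v σ')
    (hnorm : ∀ v (σ : ∀ u, S u), ∑ a : S v, k v σ a = 1)
    (hnorm' : ∀ v (σ : ∀ u, S u), ∑ a : S v, k' v σ a = 1)
    (ρ : V → ℕ) (hρ : ∀ u v, u ∈ pa v → ρ u < ρ v)
    (A : Finset V) (hA : ∀ v ∈ A, pa v ⊆ A) (hk : ∀ v ∈ A, k v = k' v)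
    (W : Finset V) (hW : W ⊆ A) (w : ∀ v, S v) :
    marginal (jointP k) W w = marginal (jointP k') W w := by
  have hg : ∀ σ σ' : ∀ v, S v, (∀ u ∈ A, σ u = σ' u) →
      (if ∀ u ∈ W, σ u = w u then (1 : NNReal) else 0)
        = if ∀ u ∈ W, σ' u = w u then (1 : NNReal) else 0 := by
    intro σ σ' hσ
    refine if_congr (forall₂_congr fun u hu => ?_) rfl rfl
    rw [hσ u (hW hu)]
  have hsum := sum_mul_prod_union_eq_of_ancestral pa k hloc hnorm ρ hρ A hA _ hg Aᶜ
    disjoint_compl_right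
  have hsum' := sum_mul_prod_union_eq_of_ancestral pa k' hloc' hnorm' ρ hρ A hA _ hg Aᶜ
    disjoint_compl_right
  have hprod : ∀ σ : ∀ v, S v, ∏ v ∈ A, k v σ (σ v) = ∏ v ∈ A, k' v σ (σ v) :=
    fun σ => Finset.prod_congr rfl fun v hv => by rw [hk v hv]
  simp_rw [hprod] at hsum
  simpa [marginal, jointP] using hsum.trans hsum'.symm

/-- The kernels of the intervened model: point masses at `ξ` on `T`, unchanged elsewhere. -/
noncomputable def doKernel (k : ∀ v, (∀ u, S u) → S v → NNReal) (T : Finset V) (ξ : ∀ v, S v)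
    (v : V) (σ : ∀ u, S u) (a : S v) : NNReal :=
  if v ∈ T then (if a = ξ v then 1 else 0) else k v σ a

set_option linter.unusedSectionVars false in
/-- Truncated factorization is the joint pmf of the intervened model. -/
theorem doP_eq_jointP_doKernel (k : ∀ v, (∀ u, S u) → S v → NNReal) (T : Finset V)
    (ξ : ∀ v, S v) : doP k T ξ = jointP (doKernel k T ξ) := by
  funext σ
  have hT : ∏ v ∈ T, doKernel k T ξ v σ (σ v) = if ∀ u ∈ T, σ u = ξ u then 1 else 0 := by
    calc _ = ∏ v ∈ T, if σ v = ξ v then (1 : NNReal) else 0 :=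
          Finset.prod_congr rfl fun v hv => by simp [doKernel, hv]
      _ = _ := by
        rw [Finset.prod_ite_zero, Finset.prod_const_one]
        congr
  have hTc : ∏ v ∈ Tᶜ, doKernel k T ξ v σ (σ v) = ∏ v ∈ Tᶜ, k v σ (σ v) :=
    Finset.prod_congr rfl fun v hv => by simp [doKernel, Finset.mem_compl.mp hv]
  rw [jointP, ← Finset.prod_mul_prod_compl T, hT, hTc, doP, ite_mul, one_mul, zero_mul]

/-- **Theorem 5.** In the SEM produced by Algorithm 1, with a latent root `h` and
original variables `o 0, …, o (n-1)` whose sole parent is `h`, intervening on any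
subset `T` of the original variables leaves the marginal of the remaining original
variables `W = {o 0, …, o (n-1)} ∖ T` unchanged. -/
theorem psdd_sem_intervention_on_original_trivial
    (pa : V → Finset V)
    (k : ∀ v, (∀ u, S u) → S v → NNReal)
    (hpa : ∀ v, v ∉ pa v)
    (hloc : ∀ v (σ σ' : ∀ u, S u), (∀ u ∈ pa v, σ u = σ' u) → k v σ = k v σ')
    (hnorm : ∀ v (σ : ∀ u, S u), ∑ a : S v, k v σ a = 1)
    (htopo : ∃ ρ : V → ℕ, Function.Injective ρ ∧ ∀ u v, u ∈ pa v → ρ u < ρ v)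
    (n : ℕ) (h : V) (o : Fin n → V)
    (ho : Function.Injective o) (hoh : ∀ i, o i ≠ h)
    (hpah : pa h = ∅)
    (hpao : ∀ i, pa (o i) = {h})
    (T : Finset V) (hT : T ⊆ Finset.image o Finset.univ)
    (ξ w : ∀ v, S v) :
    marginal (doP k T ξ) (Finset.image o Finset.univ \ T) w
      = marginal (jointP k) (Finset.image o Finset.univ \ T) w := by
  obtain ⟨ρ, -, hρ⟩ := htopo
  have hhT : h ∉ T := fun hh => by
    obtain ⟨i, -, hi⟩ := Finset.mem_image.mp (hT hh)
    exact hoh i hi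
  rw [doP_eq_jointP_doKernel]
  refine marginal_jointP_congr_of_ancestral pa _ k ?_ hloc ?_ hnorm ρ hρ
    (insert h (Finset.image o Finset.univ \ T)) ?_ ?_ _ (Finset.subset_insert _ _) w
  · intro v σ σ' hσ
    funext a
    simp only [doKernel, hloc v σ σ' hσ]
  · intro v σ
    by_cases hv : v ∈ T <;> simp [doKernel, hv, hnorm]
  · intro v hv
    rcases Finset.mem_insert.mp hv with rfl | hv
    · simp [hpah]
    · obtain ⟨i, -, rfl⟩ := Finset.mem_image.mp (Finset.mem_sdiff.mp hv).1
      simp [hpao]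
  · intro v hv
    have hvT : v ∉ T := by
      rcases Finset.mem_insert.mp hv with rfl | hv
      · exact hhT
      · exact (Finset.mem_sdiff.mp hv).2
    funext σ a
    simp [doKernel, hvT]
end

section
/- (Ancestral marginalization lemma.) Let a factorized Bayesian-network model over variables V be given, admitting a topological ordering, and let W ⊆ V be ancestrally closed, i.e. pa v ⊆ W for every v ∈ W. Then for every assignment w on W, the marginal equals the product of the kernels of the nodes in W: P_W(w) = ∏_{v ∈ W} k v σ_w (w v), where σ_w is any full assignment agreeing with w on W (the right-hand side is independent of the choice of σ_w, since each k v for v ∈ W depends only on the coordinates in pa v ⊆ W). -/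
open Finset

variable {V : Type*} [Fintype V] [DecidableEq V]
variable {S : V → Type*} [∀ v, Fintype (S v)] [∀ v, DecidableEq (S v)] [∀ v, Nonempty (S v)]

/-- Summing a single indicator over the value at a fresh variable `m` frees that variable. -/
lemma sum_ite_agree_update (A : Finset V) (m : V) (hm : m ∉ A) (x σ : ∀ v, S v) (c : NNReal) :
    (∑ a : S m, if ∀ u, u ∉ A → σ u = Function.update x m a u then c else 0) =
      if ∀ u, u ∉ insert m A → σ u = x u then c else 0 := by
  have key (a : S m) : (∀ u, u ∉ A → σ u = Function.update x m a u) ↔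
      σ m = a ∧ ∀ u, u ∉ insert m A → σ u = x u := by
    constructor
    · intro h
      refine ⟨by simpa using h m hm, fun u hu => ?_⟩
      rw [Finset.mem_insert, not_or] at hu
      simpa [Function.update_of_ne hu.1] using h u hu.2
    · rintro ⟨h, h'⟩ u hu
      by_cases hum : u = m
      · subst hum
        simpa using h
      · rw [Function.update_of_ne hum]
        exact h' u (by simp [hum, hu])
  simp only [key, ite_and, Finset.sum_ite_eq, Finset.mem_univ, if_true]

/-- With the variables outside `A` held fixed, the product of the kernels of the nodes in `A`
has total mass one. -/
lemma sum_prod_kernel_eq_one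
    (pa : V → Finset V)
    (k : ∀ v, (∀ u, S u) → S v → NNReal)
    (hloc : ∀ v (σ σ' : ∀ u, S u), (∀ u ∈ pa v, σ u = σ' u) → k v σ = k v σ')
    (hnorm : ∀ v (σ : ∀ u, S u), ∑ a : S v, k v σ a = 1)
    (ρ : V → ℕ) (hρ : ∀ u v, u ∈ pa v → ρ u < ρ v)
    (A : Finset V) (x : ∀ v, S v) :
    (∑ σ : ∀ v, S v, if ∀ u, u ∉ A → σ u = x u then ∏ v ∈ A, k v σ (σ v) else 0) = 1 := by
  induction A using Finset.induction_on_min_value ρ generalizing x with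
  | empty => simp [← funext_iff]
  | insert m A hm hmin ih =>
    simp_rw [← sum_ite_agree_update A m hm x]
    rw [Finset.sum_comm, ← hnorm m x]
    refine Finset.sum_congr rfl fun a _ => ?_
    rw [← mul_one (k m x a), ← ih (Function.update x m a), Finset.mul_sum]
    refine Finset.sum_congr rfl fun σ _ => ?_
    split_ifs with h
    · have hσm : σ m = a := by simpa using h m hm
      have hk : k m σ = k m x := by
        refine hloc m σ x fun u hu => ?_
        have hlt := hρ u m hu
        have hne : u ≠ m := by
          rintro rfl
          exact lt_irrefl _ hlt
        have huA : u ∉ A := fun hA => (hmin u hA).not_gt hlt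
        simpa [Function.update_of_ne hne] using h u huA
      rw [Finset.prod_insert hm, hk, hσm]
    · rw [mul_zero]

/-- **Ancestral marginalization.** If `W` is ancestrally closed (`pa v ⊆ W` for every
`v ∈ W`), then the marginal on `W` equals the product over `v ∈ W` of the kernels,
evaluated at any full assignment `σw` agreeing with `w` on `W`. -/
theorem ancestral_marginalization
    (pa : V → Finset V)
    (k : ∀ v, (∀ u, S u) → S v → NNReal)
    (hpa : ∀ v, v ∉ pa v)
    (hloc : ∀ v (σ σ' : ∀ u, S u), (∀ u ∈ pa v, σ u = σ' u) → k v σ = k v σ')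
    (hnorm : ∀ v (σ : ∀ u, S u), ∑ a : S v, k v σ a = 1)
    (htopo : ∃ ρ : V → ℕ, Function.Injective ρ ∧ ∀ u v, u ∈ pa v → ρ u < ρ v)
    (W : Finset V) (hW : ∀ v ∈ W, pa v ⊆ W)
    (w σw : ∀ v, S v) (hagree : ∀ u ∈ W, σw u = w u) :
    marginal (jointP k) W w = ∏ v ∈ W, k v σw (w v) := by
  obtain ⟨ρ, -, hρ⟩ := htopo
  rw [← mul_one (∏ v ∈ W, k v σw (w v)),
    ← sum_prod_kernel_eq_one pa k hloc hnorm ρ hρ Wᶜ w, Finset.mul_sum, marginal]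
  refine Finset.sum_congr rfl fun σ _ => ?_
  simp only [Finset.mem_compl, not_not]
  split_ifs with h
  · rw [jointP, ← Finset.prod_mul_prod_compl W]
    congr 1
    refine Finset.prod_congr rfl fun v hv => ?_
    rw [h v hv, hloc v σ σw fun u hu => by rw [h u (hW v hv hu), hagree u (hW v hv hu)]]
  · rw [mul_zero]
end

section
/- (Prime bases carry the mixture weights, and the coordinates of a PSDD decision node are conditionally independent given each prime base.) In the decision-node setting, for each j : Fin k let B j := {(x, y) : α × β | q j x > 0} (the prime base of the j-th prime). Then: (i) p(B j) := ∑_{(x,y) ∈ B j} p (x, y) = θ j; and (ii) if θ j > 0, then for every (x, y) ∈ B j, p (x, y) / θ j = q j x · r j y; that is, the conditional distribution of (x, y) given the event B j is the product distribution q j ⊗ r j, so the two coordinates are conditionally independent given each prime base, and consequently p (x, y) = ∑_{j} p(B j) · (conditional pmf of x given B j) · (conditional pmf of y given B j). -/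
open Finset

/-- The decision-node pmf `p (x, y) = ∑ i, θ i * q i x * r i y`. -/
noncomputable def dnodePmf {α β : Type*} [Fintype α] [Fintype β] {k : ℕ}
    (θ : Fin k → NNReal) (q : Fin k → α → NNReal) (r : Fin k → β → NNReal)
    (xy : α × β) : NNReal :=
  ∑ i : Fin k, θ i * q i xy.1 * r i xy.2

/-- The probability of the `j`-th prime base `B j = {(x, y) | q j x > 0}` under the
decision-node pmf. -/
noncomputable def basePr {α β : Type*} [Fintype α] [Fintype β] {k : ℕ}
    (θ : Fin k → NNReal) (q : Fin k → α → NNReal) (r : Fin k → β → NNReal)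
    (j : Fin k) : NNReal :=
  ∑ xy : α × β, if 0 < q j xy.1 then dnodePmf θ q r xy else 0

/-- The conditional pmf of the first coordinate given the prime base `B j`. -/
noncomputable def condFst {α β : Type*} [Fintype α] [Fintype β] {k : ℕ}
    (θ : Fin k → NNReal) (q : Fin k → α → NNReal) (r : Fin k → β → NNReal)
    (j : Fin k) (x : α) : NNReal :=
  (∑ y : β, if 0 < q j x then dnodePmf θ q r (x, y) else 0) / basePr θ q r j

/-- The conditional pmf of the second coordinate given the prime base `B j`. -/
noncomputable def condSnd {α β : Type*} [Fintype α] [Fintype β] {k : ℕ}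
    (θ : Fin k → NNReal) (q : Fin k → α → NNReal) (r : Fin k → β → NNReal)
    (j : Fin k) (y : β) : NNReal :=
  (∑ x : α, if 0 < q j x then dnodePmf θ q r (x, y) else 0) / basePr θ q r j

/-- Restricted to a prime base, only the corresponding mixture component survives. -/
lemma ite_dnodePmf_eq {α β : Type*} [Fintype α] [Fintype β] {k : ℕ}
    (θ : Fin k → NNReal) (q : Fin k → α → NNReal) (r : Fin k → β → NNReal)
    (hdisj : ∀ i j : Fin k, i ≠ j → ∀ x : α, 0 < q i x → q j x = 0)
    (j : Fin k) (x : α) (y : β) :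
    (if 0 < q j x then dnodePmf θ q r (x, y) else 0) = θ j * q j x * r j y := by
  split_ifs with h
  · refine Finset.sum_eq_single j (fun i _ hij => ?_) (by simp)
    simp [hdisj j i hij.symm x h]
  · simp [nonpos_iff_eq_zero.mp (not_lt.mp h)]

lemma basePr_eq {α β : Type*} [Fintype α] [Fintype β] {k : ℕ}
    (θ : Fin k → NNReal) (q : Fin k → α → NNReal) (r : Fin k → β → NNReal)
    (hq : ∀ i, ∑ x : α, q i x = 1) (hr : ∀ i, ∑ y : β, r i y = 1)
    (hdisj : ∀ i j : Fin k, i ≠ j → ∀ x : α, 0 < q i x → q j x = 0) (j : Fin k) :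
    basePr θ q r j = θ j := by
  simp only [basePr, Fintype.sum_prod_type, ite_dnodePmf_eq θ q r hdisj, ← Finset.mul_sum,
    hr, hq, mul_one]

/-- **Prime bases carry the mixture weights; coordinates are conditionally independent
given each prime base.** (i) `p(B j) = θ j`; (ii) if `θ j > 0`, then on `B j` the
conditional distribution is the product `q j ⊗ r j`; and consequently
`p (x, y) = ∑ j, p(B j) * P(x | B j) * P(y | B j)`. -/
theorem psdd_prime_bases_and_conditional_independence
    {α β : Type*} [Fintype α] [Fintype β] {k : ℕ}
    (q : Fin k → α → NNReal) (r : Fin k → β → NNReal) (θ : Fin k → NNReal)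
    (hq : ∀ i, ∑ x : α, q i x = 1) (hr : ∀ i, ∑ y : β, r i y = 1)
    (hθ : ∑ i : Fin k, θ i = 1)
    (hdisj : ∀ i j : Fin k, i ≠ j → ∀ x : α, 0 < q i x → q j x = 0) :
    (∀ j : Fin k, basePr θ q r j = θ j) ∧
    (∀ j : Fin k, 0 < θ j → ∀ (x : α) (y : β), 0 < q j x →
      dnodePmf θ q r (x, y) / θ j = q j x * r j y) ∧
    (∀ (x : α) (y : β),
      dnodePmf θ q r (x, y)
        = ∑ j : Fin k, basePr θ q r j * condFst θ q r j x * condSnd θ q r j y) := by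
  have hbase := basePr_eq θ q r hq hr hdisj
  refine ⟨hbase, fun j hj x y hx => ?_, fun x y => Finset.sum_congr rfl fun j _ => ?_⟩
  · have h := ite_dnodePmf_eq θ q r hdisj j x y
    rw [if_pos hx] at h
    rw [h, mul_assoc, mul_div_cancel_left₀ _ hj.ne']
  · simp only [condFst, condSnd, hbase, ite_dnodePmf_eq θ q r hdisj, ← Finset.mul_sum,
      ← Finset.sum_mul, hr, hq, mul_one]
    rcases eq_or_ne (θ j) 0 with h | h
    · simp [h]
    · rw [mul_div_cancel_left₀ _ h, mul_div_cancel_left₀ _ h]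
end
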